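/- Let γ be a primitive element of F_{p^N} and B = [b_{i,l}] a matrix over F_{p^N} such that: (1) every nonzero entry is a power γ^{β_{i,l}} with β_{i,l} ≥ 1; (2) if b_{i,l} = 0 then b_{i',l} = 0 for all i' > i or b_{i,l'} = 0 for all l' < l; (3) if l < l' and b_{i,l}, b_{i,l'} ≠ 0 then 2β_{i,l} ≤ β_{i,l'}; (4) if i < i' and b_{i,l}, b_{i',l} ≠ 0 then 2β_{i,l} ≤ β_{i',l}. If N is greater than every exponent of γ appearing in a nontrivial term of any minor of B, then B is superregular, i.e., every minor of B that is not trivially zero is nonzero. -/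

import Mathlib

open Matrix

/-- A square submatrix (given by row and column embeddings) of `B` has a trivially zero
determinant if the determinant vanishes for every matrix with the same (or smaller)
support, i.e. when the nonzero entries are treated as arbitrary. -/
def TriviallyZeroMinor {F : Type*} [Field F] {a b s : ℕ}
    (B : Matrix (Fin a) (Fin b) F) (r : Fin s ↪ Fin a) (c : Fin s ↪ Fin b) : Prop :=
  ∀ B' : Matrix (Fin a) (Fin b) F, (∀ i l, B i l = 0 → B' i l = 0) →
    ((B'.submatrix r c).det = 0)

/-- Let `σ` and `τ` be permutations supported on `S`, neither of which contains a pair of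
increasing positions that can be exchanged inside `S`. Then `τ` is pointwise at most `σ`. -/
theorem le_of_no_increasing_exchange {α : Type*} [Fintype α] {S : α → α → Prop} {u v : α → ℕ}
    (hu : Function.Injective u) (hv : Function.Injective v) {σ τ : Equiv.Perm α}
    (hσS : ∀ i, S i (σ i)) (hτS : ∀ i, S i (τ i))
    (hσ : ∀ i j, u i < u j → v (σ i) < v (σ j) → ¬ S j (σ i))
    (hτ : ∀ i j, u i < u j → v (τ i) < v (τ j) → ¬ S j (τ i)) (i : α) :
    v (τ i) ≤ v (σ i) := by
  classical
  set P : Finset α := Finset.univ.filter fun i => v (σ i) < v (τ i) with hP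
  set f : α → α := fun i => τ.symm (σ i) with hf
  have hτf : ∀ i, τ (f i) = σ i := fun i => by simp [hf]
  have hfinj : Function.Injective f := τ.symm.injective.comp σ.injective
  have hmaps : ∀ i ∈ P, f i ∈ P := by
    intro i hi
    have hi' : v (σ i) < v (τ i) := by simpa [hP] using hi
    have hne : f i ≠ i := by
      intro h
      have := hτf i
      rw [h] at this
      rw [this] at hi'
      exact lt_irrefl _ hi'
    have hlt : u i < u (f i) := by
      refine lt_of_le_of_ne (not_lt.1 fun h => ?_) fun h => hne (hu h).symm
      have := hτ (f i) i h (by rw [hτf]; exact hi')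
      rw [hτf] at this
      exact this (hσS i)
    have hle : v (σ (f i)) ≤ v (τ (f i)) := by
      refine not_lt.1 fun h => ?_
      rw [hτf] at h
      have h2 := hσ i (f i) hlt h
      rw [← hτf] at h2
      exact h2 (hτS _)
    have hne' : v (σ (f i)) ≠ v (τ (f i)) := fun h =>
      hne (σ.injective ((hv h).trans (hτf i)))
    simpa [hP] using lt_of_le_of_ne hle hne'
  have himage : P.image f = P :=
    Finset.eq_of_subset_of_card_le (Finset.image_subset_iff.2 hmaps)
      (Finset.card_image_of_injective _ hfinj).ge
  have hsum : ∑ i ∈ P, v (σ i) = ∑ i ∈ P, v (τ i) := by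
    conv_rhs => rw [← himage, Finset.sum_image hfinj.injOn]
    simp [hτf]
  by_contra! hi
  exact (Finset.sum_lt_sum_of_nonempty (s := P) ⟨i, by simpa [hP] using hi⟩
    fun j hj => by simpa [hP] using hj).ne hsum

/-- There is at most one permutation supported on `S` that contains no pair of increasing
positions that can be exchanged inside `S`. -/
theorem eq_of_no_increasing_exchange {α : Type*} [Fintype α] {S : α → α → Prop} {u v : α → ℕ}
    (hu : Function.Injective u) (hv : Function.Injective v) {σ τ : Equiv.Perm α}
    (hσS : ∀ i, S i (σ i)) (hτS : ∀ i, S i (τ i))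
    (hσ : ∀ i j, u i < u j → v (σ i) < v (σ j) → ¬ S j (σ i))
    (hτ : ∀ i j, u i < u j → v (τ i) < v (τ j) → ¬ S j (τ i)) : σ = τ :=
  Equiv.ext fun i => hv <| le_antisymm
    (le_of_no_increasing_exchange hu hv hτS hσS hτ hσ i)
    (le_of_no_increasing_exchange hu hv hσS hτS hσ hτ i)

/-- A permutation of minimal weight among those supported on `S` contains no pair of increasing
positions whose exchange stays inside `S` and lowers the weight. -/
theorem not_exchange_of_weight_le {α : Type*} [Fintype α] [DecidableEq α]
    {S : α → α → Prop} {w : α → α → ℕ} {u v : α → ℕ}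
    (hexch : ∀ i j k l, u i < u j → v k < v l → S i k → S j l → S j k →
      S i l ∧ w i l + w j k < w i k + w j l)
    {σ : Equiv.Perm α} (hσS : ∀ i, S i (σ i))
    (hmin : ∀ τ : Equiv.Perm α, (∀ i, S i (τ i)) → ∑ i, w i (σ i) ≤ ∑ i, w i (τ i))
    (i j : α) (hij : u i < u j) (hσij : v (σ i) < v (σ j)) : ¬ S j (σ i) := by
  intro hS
  obtain ⟨hS', hw⟩ := hexch i j _ _ hij hσij (hσS i) (hσS j) hS
  have hne : i ≠ j := by rintro rfl; exact lt_irrefl _ hij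
  have hother : ∀ k, k ≠ i → k ≠ j → (σ * Equiv.swap i j) k = σ k := fun k hi hj => by
    simp [Equiv.swap_apply_of_ne_of_ne hi hj]
  have hle := hmin (σ * Equiv.swap i j) fun k => by
    by_cases hki : k = i
    · subst hki; simpa using hS'
    by_cases hkj : k = j
    · subst hkj; simpa using hS
    rw [hother k hki hkj]
    exact hσS k
  have hsplit : ∀ g : α → ℕ,
      ∑ k, g k = g i + (g j + ∑ k ∈ (Finset.univ.erase i).erase j, g k) := fun g => by
    rw [Finset.add_sum_erase _ g (by simp [hne.symm]), Finset.add_sum_erase _ g (by simp)]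
  rw [hsplit, hsplit fun k => w k ((σ * Equiv.swap i j) k)] at hle
  have hrest : ∑ k ∈ (Finset.univ.erase i).erase j, w k ((σ * Equiv.swap i j) k) =
      ∑ k ∈ (Finset.univ.erase i).erase j, w k (σ k) := by
    refine Finset.sum_congr rfl fun k hk => ?_
    simp only [Finset.mem_erase] at hk
    rw [hother k hk.2.1 hk.1]
  rw [hrest] at hle
  simp only [Equiv.Perm.mul_apply, Equiv.swap_apply_left, Equiv.swap_apply_right] at hle
  omega

/-- If the powers of `γ` exhaust the nonzero elements of a field with `p ^ N` elements, then `γ`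
is not a root of a nonzero polynomial over `ZMod p` of degree less than `N`. -/
theorem aeval_ne_zero_of_degree_lt {p N : ℕ} [Fact p.Prime] {F : Type*} [Field F] [Fintype F]
    [Algebra (ZMod p) F] (hcard : Fintype.card F = p ^ N) {γ : F}
    (hγ : ∀ x : F, x ≠ 0 → ∃ m : ℕ, x = γ ^ m) {Q : Polynomial (ZMod p)} (hQ : Q ≠ 0)
    (hdeg : Q.degree < N) : Polynomial.aeval γ Q ≠ 0 := by
  intro hroot
  have htop : IntermediateField.adjoin (ZMod p) {γ} = ⊤ := by
    refine top_unique fun x _ => ?_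
    by_cases hx : x = 0
    · rw [hx]; exact zero_mem _
    · obtain ⟨m, rfl⟩ := hγ x hx
      exact pow_mem (IntermediateField.mem_adjoin_simple_self _ γ) m
  have hint : IsIntegral (ZMod p) γ := Algebra.IsIntegral.isIntegral γ
  have hfin : Module.finrank (ZMod p) F = N := by
    have h := Module.card_eq_pow_finrank (K := ZMod p) (V := F)
    rw [ZMod.card, hcard] at h
    exact (Nat.pow_right_injective (Fact.out : p.Prime).two_le h).symm
  have hnat : (minpoly (ZMod p) γ).natDegree = N := by
    rw [← IntermediateField.adjoin.finrank hint, htop, IntermediateField.finrank_top', hfin]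
  have h := minpoly.degree_le_of_ne_zero (ZMod p) γ hQ hroot
  rw [Polynomial.degree_eq_natDegree (minpoly.ne_zero hint), hnat] at h
  exact absurd hdeg (not_lt.2 h)

/-- Let `γ` be a primitive element of `F_{p^N}` and `B = [b_{i,l}]` a matrix
whose nonzero entries are powers `γ^{β_{i,l}}` with `β_{i,l} ≥ 1`, satisfying the zero
pattern condition (2) and the doubling conditions (3), (4) on the exponents. If `N` exceeds
every exponent of `γ` appearing in a nontrivial term of any minor of `B`, then `B` is
superregular: every minor of `B` that is not trivially zero is nonzero. -/
theorem superregular_of_exponent_conditions {p N a b : ℕ} (hp : p.Prime) (hN : 0 < N)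
    {F : Type*} [Field F] [Fintype F] (hcard : Fintype.card F = p ^ N)
    (γ : F) (hγ : ∀ x : F, x ≠ 0 → ∃ m : ℕ, x = γ ^ m)
    (B : Matrix (Fin a) (Fin b) F) (β : Fin a → Fin b → ℕ)
    (h1 : ∀ i l, B i l ≠ 0 → B i l = γ ^ β i l ∧ 1 ≤ β i l)
    (h2 : ∀ i l, B i l = 0 →
      (∀ i' : Fin a, i < i' → B i' l = 0) ∨ (∀ l' : Fin b, l' < l → B i l' = 0))
    (h3 : ∀ i l l', l < l' → B i l ≠ 0 → B i l' ≠ 0 → 2 * β i l ≤ β i l')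
    (h4 : ∀ i i' l, i < i' → B i l ≠ 0 → B i' l ≠ 0 → 2 * β i l ≤ β i' l)
    (hexp : ∀ (s : ℕ) (r : Fin s ↪ Fin a) (c : Fin s ↪ Fin b) (σ : Equiv.Perm (Fin s)),
      (∀ i : Fin s, B (r i) (c (σ i)) ≠ 0) → (∑ i : Fin s, β (r i) (c (σ i))) < N) :
    ∀ (s : ℕ) (r : Fin s ↪ Fin a) (c : Fin s ↪ Fin b),
      ¬ TriviallyZeroMinor B r c → (B.submatrix r c).det ≠ 0 := by
  classical
  intro s r c hnt
  set S : Fin s → Fin s → Prop := fun i l => B (r i) (c l) ≠ 0 with hS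
  set w : Fin s → Fin s → ℕ := fun i l => β (r i) (c l) with hw
  set T : Finset (Equiv.Perm (Fin s)) := Finset.univ.filter fun σ => ∀ i, S i (σ i) with hT
  have hmemT : ∀ σ, σ ∈ T ↔ ∀ i, S i (σ i) := fun σ => by simp [hT]
  have hTne : T.Nonempty := by
    by_contra hempty
    refine hnt fun B' hB' => ?_
    rw [← Matrix.det_transpose, Matrix.det_apply]
    refine Finset.sum_eq_zero fun σ _ => ?_
    have hσ : ¬ ∀ i, S i (σ i) := fun h => hempty ⟨σ, (hmemT σ).2 h⟩
    simp only [hS, not_forall, not_not] at hσ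
    obtain ⟨i, hi⟩ := hσ
    rw [Finset.prod_eq_zero (Finset.mem_univ i) (by simpa using hB' _ _ hi), smul_zero]
  have hexch : ∀ i j k l : Fin s, (r i : ℕ) < r j → (c k : ℕ) < c l → S i k → S j l → S j k →
      S i l ∧ w i l + w j k < w i k + w j l := by
    intro i j k l hij hkl hik hjl hjk
    have hil : S i l := fun h0 => (h2 _ _ h0).elim (fun h => hjl (h _ hij)) fun h => hik (h _ hkl)
    refine ⟨hil, ?_⟩
    have ha := h3 _ _ _ hkl hjk hjl
    have hb := h4 _ _ _ hij hil hjl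
    have hc := (h1 _ _ hik).2
    simp only [hw]
    omega
  obtain ⟨σ₀, hσ₀, hmin⟩ := T.exists_min_image (fun σ => ∑ i, w i (σ i)) hTne
  have hnoexch : ∀ σ ∈ T, ∑ i, w i (σ i) ≤ ∑ i, w i (σ₀ i) →
      ∀ i j, (r i : ℕ) < r j → (c (σ i) : ℕ) < c (σ j) → ¬ S j (σ i) := fun σ hσ hle =>
    not_exchange_of_weight_le hexch ((hmemT σ).1 hσ)
      fun τ hτ => hle.trans (hmin τ ((hmemT τ).2 hτ))
  have huniq : ∀ σ ∈ T, ∑ i, w i (σ i) = ∑ i, w i (σ₀ i) → σ = σ₀ := fun σ hσ heq =>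
    eq_of_no_increasing_exchange (S := S) (u := fun i => (r i : ℕ)) (v := fun i => (c i : ℕ))
      (Fin.val_injective.comp r.injective) (Fin.val_injective.comp c.injective)
      ((hmemT σ).1 hσ) ((hmemT σ₀).1 hσ₀) (hnoexch σ hσ heq.le) (hnoexch σ₀ hσ₀ le_rfl)
  have : Fact p.Prime := ⟨hp⟩
  have : CharP F p := charP_of_card_eq_prime_pow hcard
  let _ : Algebra (ZMod p) F := ZMod.algebra F p
  set Q : Polynomial (ZMod p) := ∑ σ ∈ T,
    Polynomial.C ((Equiv.Perm.sign σ : ℤ) : ZMod p) * Polynomial.X ^ (∑ i, w i (σ i)) with hQ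
  have hQdet : Polynomial.aeval γ Q = (B.submatrix r c).det := by
    rw [← Matrix.det_transpose, Matrix.det_apply', hQ, map_sum]
    refine Finset.sum_subset_zero_on_sdiff (Finset.subset_univ _) (fun σ hσ => ?_) fun σ hσ => ?_
    · have hσ' : ¬ ∀ i, S i (σ i) := fun h => (Finset.mem_sdiff.1 hσ).2 ((hmemT σ).2 h)
      simp only [hS, not_forall, not_not] at hσ'
      obtain ⟨i, hi⟩ := hσ'
      rw [Finset.prod_eq_zero (Finset.mem_univ i) (by simpa using hi), mul_zero]
    · rw [map_mul, map_pow, Polynomial.aeval_X, Polynomial.aeval_C, map_intCast,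
        ← Finset.prod_pow_eq_pow_sum]
      congr 1
      exact Finset.prod_congr rfl fun i _ => ((h1 _ _ ((hmemT σ).1 hσ i)).1).symm
  rw [← hQdet]
  refine aeval_ne_zero_of_degree_lt hcard hγ (fun h0 => ?_) ?_
  · have hcoeff : Q.coeff (∑ i, w i (σ₀ i)) = ((Equiv.Perm.sign σ₀ : ℤ) : ZMod p) := by
      rw [hQ, Polynomial.finsetSum_coeff, Finset.sum_eq_single_of_mem σ₀ hσ₀ fun σ hσ hne => ?_]
      · simp
      · rw [Polynomial.coeff_C_mul_X_pow, if_neg fun h => hne (huniq σ hσ h.symm)]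
    rw [h0, Polynomial.coeff_zero] at hcoeff
    rcases Int.units_eq_one_or (Equiv.Perm.sign σ₀) with h | h <;> simp [h] at hcoeff
  · refine (Polynomial.degree_lt_iff_coeff_zero _ _).2 fun n hn => ?_
    rw [hQ, Polynomial.finsetSum_coeff]
    refine Finset.sum_eq_zero fun σ hσ => ?_
    have hlt : ∑ i, w i (σ i) < N := hexp s r c σ ((hmemT σ).1 hσ)
    rw [Polynomial.coeff_C_mul_X_pow, if_neg (by omega)]
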